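/- Let A, B be N×N real matrices, D an N×M real matrix, and 𝓡 the associated enlarged Kalman matrix. Define μ as the supremum over complex α, β of dim Ker of the 2N×N matrix stacking (Aᵀ − αI) over (Bᵀ − βI), i.e., the maximal dimension of a joint eigenspace {x : Aᵀx = αx and Bᵀx = βx}. If Ker(𝓡ᵀ) = {0}, then rank(D) ≥ μ. -/

import Mathlib

open Matrix

/-- The product of a word in the matrices `A` and `B`. -/
noncomputable def wordProd {R : Type} [CommRing R] {n : ℕ}
    (A B : Matrix (Fin n) (Fin n) R) (w : List Bool) : Matrix (Fin n) (Fin n) R :=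
  (w.map fun b => if b then A else B).prod

/-- `Ker(𝓡ᵀ)` for the enlarged Kalman matrix `𝓡 = (A^p B^q ⋯ A^r B^s D)_{p,q,…,r,s}`:
the set of `x` with `Dᵀ (Bᵀ)^s (Aᵀ)^r ⋯ (Bᵀ)^q (Aᵀ)^p x = 0` for all exponents. -/
noncomputable def kalmanKer {R : Type} [CommRing R] {N M : ℕ}
    (A B : Matrix (Fin N) (Fin N) R) (D : Matrix (Fin N) (Fin M) R) :
    Submodule R (Fin N → R) :=
  ⨅ w : List Bool,
    LinearMap.ker (D.transpose.mulVecLin.comp (wordProd A.transpose B.transpose w).mulVecLin)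


/-- if `Ker(𝓡ᵀ) = {0}` then `rank D ≥ μ`, where
`μ = sup_{α,β} dim Ker (Aᵀ−αI; Bᵀ−βI)` is the maximal dimension of a joint eigenspace
of `Aᵀ` and `Bᵀ`. -/
theorem rankD_ge_mu {N M : ℕ}
    (A B : Matrix (Fin N) (Fin N) ℂ) (D : Matrix (Fin N) (Fin M) ℂ)
    (h : kalmanKer A B D = ⊥) :
    (⨆ α : ℂ, ⨆ β : ℂ, Module.finrank ℂ
        (LinearMap.ker (A.transpose.mulVecLin - α • LinearMap.id) ⊓
          LinearMap.ker (B.transpose.mulVecLin - β • LinearMap.id) :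
          Submodule ℂ (Fin N → ℂ))) ≤ D.rank := by
  refine ciSup_le fun α => ciSup_le fun β => ?_
  set E : Submodule ℂ (Fin N → ℂ) :=
    LinearMap.ker (A.transpose.mulVecLin - α • LinearMap.id) ⊓
      LinearMap.ker (B.transpose.mulVecLin - β • LinearMap.id) with hE
  have hword : ∀ (w : List Bool) (x : Fin N → ℂ), x ∈ E →
      ∃ c : ℂ, wordProd A.transpose B.transpose w *ᵥ x = c • x := by
    intro w x hx
    have hA : A.transpose *ᵥ x = α • x := by
      have := hx.1
      simpa [sub_eq_zero, Matrix.mulVec_transpose] using this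
    have hB : B.transpose *ᵥ x = β • x := by
      have := hx.2
      simpa [sub_eq_zero, Matrix.mulVec_transpose] using this
    induction w with
    | nil => exact ⟨1, by simp [wordProd]⟩
    | cons b w ih =>
      obtain ⟨c, hc⟩ := ih
      have hcons : wordProd A.transpose B.transpose (b :: w) =
          (if b then A.transpose else B.transpose) * wordProd A.transpose B.transpose w := by
        simp [wordProd]
      rw [hcons, ← Matrix.mulVec_mulVec, hc, Matrix.mulVec_smul]
      cases b
      · exact ⟨c * β, by simp [hB, smul_smul]⟩
      · exact ⟨c * α, by simp [hA, smul_smul]⟩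
  have hinj : Function.Injective (D.transpose.mulVecLin.domRestrict E) := by
    rw [← LinearMap.ker_eq_bot, LinearMap.ker_eq_bot']
    rintro ⟨x, hx⟩ h0
    have h0' : D.transpose *ᵥ x = 0 := h0
    have hmem : x ∈ kalmanKer A B D := by
      unfold kalmanKer
      rw [Submodule.mem_iInf]
      intro w
      obtain ⟨c, hc⟩ := hword w x hx
      rw [LinearMap.mem_ker, LinearMap.comp_apply, Matrix.mulVecLin_apply,
        Matrix.mulVecLin_apply, hc, Matrix.mulVec_smul, h0', smul_zero]
    rw [h, Submodule.mem_bot] at hmem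
    exact Subtype.ext hmem
  rw [← Matrix.rank_transpose D, Matrix.rank, ← LinearMap.finrank_range_of_inj hinj]
  apply Submodule.finrank_mono
  rintro _ ⟨x, rfl⟩
  exact ⟨x, rfl⟩
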